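/- Let F_q be a finite field of odd characteristic, a ∈ F_q, and n ≥ 1 an integer with gcd(n+1, q) = 1. Then the code C_n(a) with generator matrix (I_n | T_n(a)) is LCD — equivalently, the matrix I_n + T_n(a)² is invertible — if and only if a ∉ { −μ + θ^i + θ^{−i} : 1 ≤ i ≤ n } ∪ { μ + θ^i + θ^{−i} : 1 ≤ i ≤ n }, where μ is an element of an algebraic closure of F_q with μ² = −1, θ is a primitive 2(n+1)-th root of unity in that closure, and F_q is identified with its image in the closure. -/

import Mathlib

/-- The `n × n` tridiagonal Toeplitz matrix with diagonal entries `a` and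
sub/super-diagonal entries `b`. -/
def triToeplitz (F : Type*) [Field F] (n : ℕ) (a b : F) :
    Matrix (Fin n) (Fin n) F :=
  Matrix.of fun i j =>
    if (i : ℕ) = (j : ℕ) then a
    else if (i : ℕ) + 1 = (j : ℕ) ∨ (j : ℕ) + 1 = (i : ℕ) then b
    else 0

theorem triToeplitz_map {F K : Type*} [Field F] [Field K] (f : F →+* K) (n : ℕ) (a b : F) :
    (triToeplitz F n a b).map f = triToeplitz K n (f a) (f b) := by
  ext i j
  simp only [triToeplitz, Matrix.map_apply, Matrix.of_apply]
  split_ifs <;> simp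

theorem triToeplitz_add_smul_one {K : Type*} [Field K] (n : ℕ) (a b c : K) :
    triToeplitz K n a b + c • 1 = triToeplitz K n (a + c) b := by
  ext i j
  simp only [triToeplitz, Matrix.add_apply, Matrix.smul_apply, Matrix.of_apply,
    Matrix.one_apply, Fin.ext_iff]
  split_ifs <;> simp

theorem det_triToeplitz_add_two {K : Type*} [Field K] (n : ℕ) (a b : K) :
    (triToeplitz K (n + 2) a b).det =
      a * (triToeplitz K (n + 1) a b).det - b ^ 2 * (triToeplitz K n a b).det := by
  have h0 : (triToeplitz K (n + 2) a b).submatrix Fin.succ (Fin.succAbove 0) =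
      triToeplitz K (n + 1) a b := by
    ext i j
    simp [triToeplitz]
  have h1 : ((triToeplitz K (n + 2) a b).submatrix Fin.succ (Fin.succAbove 1)).det =
      b * (triToeplitz K n a b).det := by
    rw [Matrix.det_succ_column_zero, Fin.sum_univ_succ, Finset.sum_eq_zero]
    · have : ((triToeplitz K (n + 2) a b).submatrix Fin.succ (Fin.succAbove 1)).submatrix
          (Fin.succAbove 0) Fin.succ = triToeplitz K n a b := by
        ext i j
        have : (Fin.succAbove (1 : Fin (n + 2)) j.succ) = j.succ.succ :=
          Fin.succAbove_of_le_castSucc _ _ (by simp [Fin.le_def])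
        simp [triToeplitz, this]
      rw [this]
      simp [triToeplitz]
    · intro i _
      simp [triToeplitz]
  rw [Matrix.det_succ_row_zero, Fin.sum_univ_succ, Fin.sum_univ_succ, Finset.sum_eq_zero]
  · rw [h0, show (Fin.succ 0 : Fin (n + 2)) = 1 from rfl, h1]
    simp [triToeplitz]
    ring
  · intro i _
    simp [triToeplitz]

theorem det_triToeplitz_mul_sub {K : Type*} [Field K] {z w : K} (h : z * w = 1) (n : ℕ) :
    (triToeplitz K n (z + w) 1).det * (z - w) = z ^ (n + 1) - w ^ (n + 1) := by
  induction n using Nat.twoStepInduction with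
  | zero => simp
  | one => simp [triToeplitz]; ring
  | more n ih₁ ih₂ =>
    rw [det_triToeplitz_add_two]
    linear_combination (z + w) * ih₂ - ih₁ + (z ^ (n + 1) - w ^ (n + 1)) * h

theorem det_triToeplitz_of_sq_eq_one {K : Type*} [Field K] {z : K} (h : z ^ 2 = 1) (n : ℕ) :
    (triToeplitz K n (z + z) 1).det = (n + 1) * z ^ n := by
  induction n using Nat.twoStepInduction with
  | zero => simp
  | one => simp [triToeplitz]; ring
  | more n ih₁ ih₂ =>
    rw [det_triToeplitz_add_two, ih₁, ih₂]
    push_cast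
    linear_combination (n + 1) * z ^ n * h

theorem exists_add_inv_eq {K : Type*} [Field K] [IsAlgClosed K] (x : K) :
    ∃ z : K, z ≠ 0 ∧ x = z + z⁻¹ := by
  obtain ⟨z, hz⟩ := IsAlgClosed.exists_root
    (Polynomial.C 1 * Polynomial.X ^ 2 + Polynomial.C (-x) * Polynomial.X + Polynomial.C 1)
    (by rw [Polynomial.degree_quadratic one_ne_zero]; decide)
  have hz : z ^ 2 - x * z + 1 = 0 := by simpa [sub_eq_add_neg] using hz
  have h0 : z ≠ 0 := by rintro rfl; simp at hz
  refine ⟨z, h0, ?_⟩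
  field_simp
  linear_combination -hz

theorem det_triToeplitz_eq_zero_iff {K : Type*} [Field K] [IsAlgClosed K] {n : ℕ}
    (hn : ((n : K) + 1) ≠ 0) {θ : K} (hθ : IsPrimitiveRoot θ (2 * (n + 1))) (x : K) :
    (triToeplitz K n x 1).det = 0 ↔ ∃ i ∈ Set.Icc 1 n, x = θ ^ i + θ⁻¹ ^ i := by
  have hθ0 : θ ≠ 0 := hθ.ne_zero (by omega)
  have key (z w : K) (h : z * w = 1) (hne : z ≠ w) :
      (triToeplitz K n (z + w) 1).det = 0 ↔ z ^ (2 * (n + 1)) = 1 := by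
    have hzw : z ^ (n + 1) * w ^ (n + 1) = 1 := by rw [← mul_pow, h, one_pow]
    have hz : z ^ (n + 1) ≠ 0 := left_ne_zero_of_mul_eq_one hzw
    rw [← mul_left_inj' (sub_ne_zero.mpr hne), det_triToeplitz_mul_sub h, zero_mul]
    constructor
    · intro e
      linear_combination z ^ (n + 1) * e + hzw
    · intro e
      apply mul_left_cancel₀ hz
      linear_combination e - hzw
  constructor
  · intro hdet
    obtain ⟨z, hz, rfl⟩ := exists_add_inv_eq x
    have hzz : z * z⁻¹ = 1 := mul_inv_cancel₀ hz
    have hne : z ≠ z⁻¹ := by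
      intro e
      rw [← e, det_triToeplitz_of_sq_eq_one (by rw [sq]; nth_rewrite 2 [e]; exact hzz)] at hdet
      exact mul_ne_zero hn (pow_ne_zero _ hz) hdet
    have hz2 : z ^ 2 ≠ 1 := fun e => hne (eq_inv_of_mul_eq_one_left (by rw [← sq, e]))
    obtain ⟨i, hi, rfl⟩ := hθ.eq_pow_of_pow_eq_one ((key z _ hzz hne).mp hdet)
    have hi0 : i ≠ 0 := by rintro rfl; simp at hz2
    have hin : i ≠ n + 1 := by
      rintro rfl
      exact hz2 (by rw [← pow_mul, mul_comm, hθ.pow_eq_one])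
    rcases Nat.lt_or_gt_of_ne hin with h | h
    · exact ⟨i, ⟨by omega, by omega⟩, by rw [inv_pow]⟩
    · refine ⟨2 * (n + 1) - i, ⟨by omega, by omega⟩, ?_⟩
      have e : θ ^ (2 * (n + 1) - i) = (θ ^ i)⁻¹ := by
        apply eq_inv_of_mul_eq_one_left
        rw [← pow_add, Nat.sub_add_cancel hi.le, hθ.pow_eq_one]
      rw [inv_pow, e, inv_inv, add_comm]
  · rintro ⟨i, ⟨hi1, hi2⟩, rfl⟩
    have h : θ ^ i * θ⁻¹ ^ i = 1 := by rw [← mul_pow, mul_inv_cancel₀ hθ0, one_pow]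
    rw [key _ _ h, ← pow_mul, mul_comm, pow_mul, hθ.pow_eq_one, one_pow]
    intro e
    rw [← e, ← pow_add] at h
    exact hθ.pow_ne_one_of_pos_of_lt (by omega) (by omega) h

/-- Odd characteristic, `gcd(n+1,q)=1`: the double Toeplitz code `C_n(a)` is
LCD (equivalently, `1 + T_n(a)^2` is invertible) iff
`a ∉ {-μ + θ^i + θ^{-i}} ∪ {μ + θ^i + θ^{-i}}`, `1 ≤ i ≤ n`. -/
theorem stmt_7 (F : Type*) [Field F] [Fintype F]
    (p : ℕ) [Fact p.Prime] [CharP F p] (hp : Odd p)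
    (n : ℕ) (hn : 1 ≤ n) (hcop : Nat.gcd (n + 1) (Fintype.card F) = 1)
    (μ : AlgebraicClosure F) (hμ : μ ^ 2 = -1)
    (θ : AlgebraicClosure F) (hθ : IsPrimitiveRoot θ (2 * (n + 1))) (a : F) :
    IsUnit ((1 : Matrix (Fin n) (Fin n) F) + (triToeplitz F n a 1) ^ 2) ↔
      algebraMap F (AlgebraicClosure F) a ∉
        ((fun i : ℕ => -μ + θ ^ i + θ⁻¹ ^ i) '' (Set.Icc 1 n) ∪
         (fun i : ℕ => μ + θ ^ i + θ⁻¹ ^ i) '' (Set.Icc 1 n)) := by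
  set f := algebraMap F (AlgebraicClosure F)
  have hn0 : ((n : AlgebraicClosure F) + 1) ≠ 0 := by
    have : CharP (AlgebraicClosure F) p := charP_of_injective_algebraMap f.injective p
    intro h
    have h1 : p ∣ n + 1 := (CharP.cast_eq_zero_iff (AlgebraicClosure F) p (n + 1)).mp
      (by exact_mod_cast h)
    have h2 : p ∣ Fintype.card F :=
      (CharP.cast_eq_zero_iff F p _).mp (FiniteField.cast_card_eq_zero F)
    have h3 := Nat.dvd_gcd h1 h2
    rw [hcop] at h3
    exact (Fact.out : p.Prime).one_lt.ne' (Nat.dvd_one.mp h3)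
  have hfac : f.mapMatrix (1 + triToeplitz F n a 1 ^ 2) =
      triToeplitz (AlgebraicClosure F) n (f a + μ) 1 *
        triToeplitz (AlgebraicClosure F) n (f a + -μ) 1 := by
    rw [map_add, map_one, map_pow, RingHom.mapMatrix_apply, triToeplitz_map, map_one,
      ← triToeplitz_add_smul_one, ← triToeplitz_add_smul_one]
    simp only [add_mul, mul_add, Matrix.smul_mul, Matrix.mul_smul, one_mul, mul_one, smul_smul]
    rw [show -μ * μ = 1 by linear_combination -hμ, one_smul, neg_smul, sq]
    abel
  have hunit : IsUnit (1 + triToeplitz F n a 1 ^ 2) ↔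
      ¬ ((triToeplitz (AlgebraicClosure F) n (f a + μ) 1).det = 0 ∨
        (triToeplitz (AlgebraicClosure F) n (f a + -μ) 1).det = 0) := by
    rw [Matrix.isUnit_iff_isUnit_det, isUnit_iff_ne_zero, ← mul_eq_zero, ← Matrix.det_mul, ← hfac,
      ← RingHom.map_det, map_eq_zero]
  rw [hunit, det_triToeplitz_eq_zero_iff hn0 hθ, det_triToeplitz_eq_zero_iff hn0 hθ,
    Set.mem_union, Set.mem_image, Set.mem_image]
  refine not_congr (or_congr ?_ ?_) <;> refine exists_congr fun i => and_congr_right fun _ => ?_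
  · exact ⟨fun h => by linear_combination -h, fun h => by linear_combination -h⟩
  · exact ⟨fun h => by linear_combination -h, fun h => by linear_combination -h⟩
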